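/- For every log-concave real random variable X with continuous distribution, E exp(−Λ*_X(X)) ≤ 1 − 1/(4e). -/

import Mathlib

open MeasureTheory Real Set

/-- Cramér transform of a probability measure on `ℝ`. -/
noncomputable def cramer1 (μ : Measure ℝ) (x : ℝ) : ℝ :=
  ⨆ t : {t : ℝ // Integrable (fun y => Real.exp (t * y)) μ},
    (x * t.1 - Real.log (∫ y, Real.exp (t.1 * y) ∂μ))

/-- `μ` is absolutely continuous on `ℝ` with the log-concave density `f`. -/
structure HasLogConcaveDensity (μ : Measure ℝ) (f : ℝ → ℝ) : Prop where
  nonneg : ∀ x, 0 ≤ f x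
  eq_withDensity : μ = volume.withDensity fun x => ENNReal.ofReal (f x)
  logConcave : ∀ x y : ℝ, ∀ l ∈ Ioo (0 : ℝ) 1,
    f x ^ (1 - l) * f y ^ l ≤ f ((1 - l) * x + l * y)

namespace HasLogConcaveDensity

variable {μ : Measure ℝ} {f : ℝ → ℝ}

lemma mul_le_mul (h : HasLogConcaveDensity μ f) {x y z : ℝ} (hxy : x ≤ y) (hz : 0 ≤ z) :
    f x * f (y + z) ≤ f (x + z) * f y := by
  rcases hxy.eq_or_lt with rfl | hxy
  · rw [mul_comm]
  rcases hz.eq_or_lt with rfl | hz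
  · simp
  have hL : 0 < y + z - x := by linarith
  have hl : z / (y + z - x) ∈ Ioo (0 : ℝ) 1 :=
    ⟨by positivity, by rw [div_lt_one hL]; linarith⟩
  have hl' : 1 - z / (y + z - x) ∈ Ioo (0 : ℝ) 1 := ⟨by linarith [hl.2], by linarith [hl.1]⟩
  have h1 := h.logConcave x (y + z) _ hl
  have h2 := h.logConcave x (y + z) _ hl'
  have e1 : (1 - z / (y + z - x)) * x + z / (y + z - x) * (y + z) = x + z := by
    field_simp; ring
  have e2 : (1 - (1 - z / (y + z - x))) * x + (1 - z / (y + z - x)) * (y + z) = y := by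
    field_simp; ring
  rw [e1] at h1
  rw [e2] at h2
  have split : ∀ w, f w = f w ^ (1 - z / (y + z - x)) * f w ^ (z / (y + z - x)) := fun w => by
    rw [← Real.rpow_add_of_nonneg (h.nonneg w) hl'.1.le hl.1.le, sub_add_cancel, Real.rpow_one]
  have h3 := _root_.mul_le_mul h1 h2
    (mul_nonneg (Real.rpow_nonneg (h.nonneg _) _) (Real.rpow_nonneg (h.nonneg _) _)) (h.nonneg _)
  rw [sub_sub_cancel] at h3
  refine le_trans (le_of_eq ?_) h3
  calc f x * f (y + z) = _ := congrArg₂ _ (split x) (split (y + z))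
    _ = _ := by ring

lemma min_le (h : HasLogConcaveDensity μ f) {x y z : ℝ} (hxy : x ≤ y) (hyz : y ≤ z) :
    min (f x) (f z) ≤ f y := by
  rcases hxy.eq_or_lt with rfl | hxy
  · exact min_le_left _ _
  rcases hyz.eq_or_lt with rfl | hyz
  · exact min_le_right _ _
  have hL : 0 < z - x := by linarith
  have hl : (y - x) / (z - x) ∈ Ioo (0 : ℝ) 1 :=
    ⟨div_pos (by linarith) hL, by rw [div_lt_one hL]; linarith⟩
  have h1 := h.logConcave x z _ hl
  have e1 : (1 - (y - x) / (z - x)) * x + (y - x) / (z - x) * z = y := by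
    field_simp; ring
  rw [e1] at h1
  refine le_trans ?_ h1
  have hm : 0 ≤ min (f x) (f z) := le_min (h.nonneg _) (h.nonneg _)
  calc min (f x) (f z)
      = min (f x) (f z) ^ (1 - (y - x) / (z - x)) * min (f x) (f z) ^ ((y - x) / (z - x)) := by
        rw [← Real.rpow_add_of_nonneg hm (by linarith [hl.2]) hl.1.le, sub_add_cancel,
          Real.rpow_one]
    _ ≤ _ := by
        have := hl.1.le
        have : 0 ≤ 1 - (y - x) / (z - x) := by linarith [hl.2]
        gcongr
        · exact Real.rpow_nonneg (h.nonneg _) _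
        · exact min_le_left _ _
        · exact min_le_right _ _

lemma measurable (h : HasLogConcaveDensity μ f) : Measurable f := by
  refine measurable_of_Ioi fun c => Set.OrdConnected.measurableSet ⟨?_⟩
  intro x hx z hz y hy
  exact (lt_min hx hz).trans_le (h.min_le hy.1 hy.2)

lemma integrable [IsProbabilityMeasure μ] (h : HasLogConcaveDensity μ f) : Integrable f := by
  refine ⟨h.measurable.aestronglyMeasurable, ?_⟩
  rw [hasFiniteIntegral_iff_ofReal (Filter.Eventually.of_forall h.nonneg), ← setLIntegral_univ,
    ← withDensity_apply _ MeasurableSet.univ, ← h.eq_withDensity]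
  exact measure_lt_top _ _

lemma real_apply [IsProbabilityMeasure μ] (h : HasLogConcaveDensity μ f) {s : Set ℝ}
    (hs : MeasurableSet s) : μ.real s = ∫ x in s, f x := by
  rw [integral_eq_lintegral_of_nonneg_ae (Filter.Eventually.of_forall h.nonneg)
    h.measurable.aestronglyMeasurable, ← withDensity_apply _ hs, ← h.eq_withDensity, measureReal_def]

lemma real_Ioi_eq [IsProbabilityMeasure μ] (h : HasLogConcaveDensity μ f) (x : ℝ) :
    μ.real (Ioi x) = ∫ z in Ioi (0 : ℝ), f (x + z) := by
  have := (measurePreserving_add_left volume x).setIntegral_preimage_emb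
    (measurableEmbedding_addLeft x) f (Ioi x)
  rw [h.real_apply measurableSet_Ioi, ← this]
  simp

lemma nullSingletonClass (h : HasLogConcaveDensity μ f) : NullSingletonClass μ := by
  refine ⟨fun x => ?_⟩
  rw [h.eq_withDensity]
  exact withDensity_absolutelyContinuous _ _ Real.volume_singleton

/-- The hazard rate `f / μ (x, ∞)` of a log-concave density is nondecreasing. -/
lemma hazard_mono [IsProbabilityMeasure μ] (h : HasLogConcaveDensity μ f) {x y : ℝ}
    (hxy : x ≤ y) : f x * μ.real (Ioi y) ≤ f y * μ.real (Ioi x) := by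
  rw [h.real_Ioi_eq, h.real_Ioi_eq, ← integral_const_mul, ← integral_const_mul]
  refine setIntegral_mono_on ((h.integrable.comp_add_left y).const_mul _).integrableOn
    ((h.integrable.comp_add_left x).const_mul _).integrableOn measurableSet_Ioi fun z hz => ?_
  rw [mul_comm (f y)]
  exact h.mul_le_mul hxy (le_of_lt hz)

lemma real_Ioi_sub [IsProbabilityMeasure μ] (h : HasLogConcaveDensity μ f) {x y : ℝ}
    (hxy : x ≤ y) : μ.real (Ioi x) - μ.real (Ioi y) = ∫ z in Ioc x y, f z := by
  rw [← h.real_apply measurableSet_Ioc, ← Ioc_union_Ioi_eq_Ioi hxy,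
    measureReal_union (Ioc_disjoint_Ioi le_rfl) measurableSet_Ioi]
  ring

lemma continuous_real_Ioi [IsProbabilityMeasure μ] (h : HasLogConcaveDensity μ f) :
    Continuous fun x => μ.real (Ioi x) := by
  have e : (fun x => μ.real (Ioi x)) = fun x => μ.real (Ioi 0) - ∫ z in (0 : ℝ)..x, f z := by
    ext x
    rcases le_total 0 x with hx | hx
    · rw [intervalIntegral.integral_of_le hx, ← h.real_Ioi_sub hx]; ring
    · rw [intervalIntegral.integral_of_ge hx, ← h.real_Ioi_sub hx]; ring
  rw [e]
  exact continuous_const.sub (intervalIntegral.continuous_primitive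
    (fun _ _ => h.integrable.intervalIntegrable) 0)

lemma real_Iic_add_real_Ioi [IsProbabilityMeasure μ] (x : ℝ) :
    μ.real (Iic x) + μ.real (Ioi x) = 1 := by
  rw [← compl_Iic, probReal_add_probReal_compl measurableSet_Iic]

lemma exists_real_Ioi_eq [IsProbabilityMeasure μ] (h : HasLogConcaveDensity μ f) {c : ℝ}
    (hc : c ∈ Ioo (0 : ℝ) 1) : ∃ x, μ.real (Ioi x) = c := by
  have e : ∀ x, μ.real (Ioi x) = 1 - ProbabilityTheory.cdf μ x := fun x => by
    rw [ProbabilityTheory.cdf_eq_real, ← real_Iic_add_real_Ioi (μ := μ) x]; ring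
  refine mem_range_of_exists_le_of_exists_ge h.continuous_real_Ioi ?_ ?_
  · obtain ⟨a, ha⟩ := ((ProbabilityTheory.tendsto_cdf_atTop μ).eventually
      (lt_mem_nhds (show 1 - c < 1 by linarith [hc.1]))).exists
    exact ⟨a, by rw [e]; linarith⟩
  · obtain ⟨a, ha⟩ := ((ProbabilityTheory.tendsto_cdf_atBot μ).eventually
      (gt_mem_nhds (show 0 < 1 - c by linarith [hc.2]))).exists
    exact ⟨a, by rw [e]; linarith⟩

lemma map_neg (h : HasLogConcaveDensity μ f) :
    HasLogConcaveDensity (μ.map Neg.neg) fun x => f (-x) where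
  nonneg x := h.nonneg _
  eq_withDensity := by
    ext s hs
    rw [Measure.map_apply measurable_neg hs, h.eq_withDensity,
      withDensity_apply _ (measurable_neg hs), withDensity_apply _ hs]
    have := (Measure.measurePreserving_neg (volume : Measure ℝ)).setLIntegral_comp_preimage_emb
      (MeasurableEquiv.neg ℝ).measurableEmbedding (fun x => ENNReal.ofReal (f (-x))) s
    simpa using this
  logConcave x y l hl := by
    convert h.logConcave (-x) (-y) l hl using 2
    ring

lemma density_pos [IsProbabilityMeasure μ] (h : HasLogConcaveDensity μ f) {x : ℝ}
    (h1 : 0 < μ.real (Iic x)) (h2 : 0 < μ.real (Ioi x)) : 0 < f x := by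
  have key : ∀ s : Set ℝ, MeasurableSet s → 0 < μ.real s → ∃ a ∈ s, 0 < f a := by
    intro s hs hpos
    by_contra! hcon
    rw [h.real_apply hs, setIntegral_congr_fun (g := fun _ => (0 : ℝ)) hs
      (fun a ha => le_antisymm (hcon a ha) (h.nonneg a))] at hpos
    simp at hpos
  obtain ⟨a, ha, ha'⟩ := key _ measurableSet_Iic h1
  obtain ⟨b, hb, hb'⟩ := key _ measurableSet_Ioi h2
  exact (lt_min ha' hb').trans_le (h.min_le ha (le_of_lt hb))

/-- The upper tail lies below the exponential tangent to it at `x`. -/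
lemma real_Ioi_le_mul_exp [IsProbabilityMeasure μ] (h : HasLogConcaveDensity μ f) {x : ℝ}
    (hx : 0 < μ.real (Ioi x)) (y : ℝ) :
    μ.real (Ioi y) ≤ μ.real (Ioi x) * Real.exp (-(f x / μ.real (Ioi x) * (y - x))) := by
  set s := f x / μ.real (Ioi x) with hs
  have hs0 : 0 ≤ s := div_nonneg (h.nonneg _) hx.le
  have anti : ∀ {a b : ℝ}, a ≤ b → μ.real (Ioi b) ≤ μ.real (Ioi a) := fun hab =>
    measureReal_mono (Ioi_subset_Ioi hab)
  have upper : ∀ a, x ≤ a → ∀ d, 0 ≤ d →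
      μ.real (Ioi (a + d)) * (1 + s * d) ≤ μ.real (Ioi a) := by
    intro a ha d hd
    have h1 : ∫ _ in Ioc a (a + d), s * μ.real (Ioi (a + d)) ≤ ∫ z in Ioc a (a + d), f z := by
      refine setIntegral_mono_on (integrable_const _) h.integrable.integrableOn measurableSet_Ioc
        fun z hz => ?_
      have h2 := h.hazard_mono (ha.trans hz.1.le)
      calc s * μ.real (Ioi (a + d)) ≤ s * μ.real (Ioi z) := by exact mul_le_mul_of_nonneg_left (anti hz.2) hs0
        _ ≤ f z := by rw [hs, div_mul_eq_mul_div, div_le_iff₀ hx]; exact h2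
    rw [← h.real_Ioi_sub (by linarith)] at h1
    simp [hd] at h1
    linarith
  have lower : ∀ a, a ≤ x → ∀ d, 0 ≤ d →
      μ.real (Ioi (a - d)) * (1 - s * d) ≤ μ.real (Ioi a) := by
    intro a ha d hd
    have h1 : ∫ z in Ioc (a - d) a, f z ≤ ∫ _ in Ioc (a - d) a, s * μ.real (Ioi (a - d)) := by
      refine setIntegral_mono_on h.integrable.integrableOn (integrable_const _) measurableSet_Ioc
        fun z hz => ?_
      have h2 := h.hazard_mono (hz.2.trans ha)
      calc f z ≤ s * μ.real (Ioi z) := by rw [hs, div_mul_eq_mul_div, le_div_iff₀ hx]; exact h2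
        _ ≤ s * μ.real (Ioi (a - d)) := by exact mul_le_mul_of_nonneg_left (anti hz.1.le) hs0
    rw [← h.real_Ioi_sub (by linarith)] at h1
    simp [hd] at h1
    linarith
  rw [Real.exp_neg, ← div_eq_mul_inv, le_div_iff₀ (Real.exp_pos _)]
  refine le_of_tendsto
    ((Real.tendsto_one_add_div_pow_exp (s * (y - x))).const_mul (μ.real (Ioi y))) ?_
  rcases le_total x y with hxy | hxy
  · filter_upwards [Filter.eventually_gt_atTop 0] with n hn
    have hn' : (0 : ℝ) < n := by exact_mod_cast hn
    set d := (y - x) / n with hd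
    have hd0 : 0 ≤ d := div_nonneg (by linarith) hn'.le
    have iter : ∀ k : ℕ, μ.real (Ioi (x + k * d)) * (1 + s * d) ^ k ≤ μ.real (Ioi x) := by
      intro k
      induction k with
      | zero => simp
      | succ k ih =>
        refine le_trans ?_ ih
        have := upper (x + k * d) (by nlinarith [mul_nonneg (Nat.cast_nonneg (α := ℝ) k) hd0]) d hd0
        rw [pow_succ', ← mul_assoc]
        push_cast
        rw [show x + (k + 1) * d = x + k * d + d by ring]
        gcongr
    have := iter n
    rwa [show x + n * d = y by rw [hd]; field_simp; ring,
      show s * d = s * (y - x) / n by rw [hd]; ring] at this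
  · obtain ⟨N, hN⟩ := exists_nat_gt (s * (x - y))
    filter_upwards [Filter.eventually_gt_atTop 0, Filter.eventually_ge_atTop N] with n hn hnN
    have hn' : (0 : ℝ) < n := by exact_mod_cast hn
    set d := (x - y) / n with hd
    have hd0 : 0 ≤ d := div_nonneg (by linarith) hn'.le
    have hsd : 0 ≤ 1 - s * d := by
      rw [hd, ← mul_div_assoc, sub_nonneg, div_le_one hn']
      exact hN.le.trans (by exact_mod_cast hnN)
    have iter : ∀ k : ℕ, μ.real (Ioi (x - k * d)) * (1 - s * d) ^ k ≤ μ.real (Ioi x) := by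
      intro k
      induction k with
      | zero => simp
      | succ k ih =>
        refine le_trans ?_ ih
        have := lower (x - k * d) (by nlinarith [mul_nonneg (Nat.cast_nonneg (α := ℝ) k) hd0]) d hd0
        rw [pow_succ', ← mul_assoc]
        push_cast
        rw [show x - (k + 1) * d = x - k * d - d by ring]
        gcongr
    have := iter n
    rwa [show x - n * d = y by rw [hd]; field_simp; ring,
      show 1 - s * d = 1 + s * (y - x) / n by rw [hd]; ring] at this

end HasLogConcaveDensity

/-- If the upper tail is at most `q * exp (-2 t (y - x))`, then `E exp (t (X - x)) ≤ 2 √q`. -/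
lemma integrable_exp_and_integral_le (μ : Measure ℝ) [IsProbabilityMeasure μ] {x t q : ℝ}
    (ht : 0 < t) (hq : 0 < q)
    (htail : ∀ y, μ.real (Ioi y) ≤ q * Real.exp (-(2 * t * (y - x)))) :
    Integrable (fun y => Real.exp (t * (y - x))) μ ∧
      ∫ y, Real.exp (t * (y - x)) ∂μ ≤ 2 * √q := by
  have hsq : 0 < √q := Real.sqrt_pos.2 hq
  have hm : Measurable fun y => Real.exp (t * (y - x)) := by fun_prop
  have h0 : 0 ≤ᵐ[μ] fun y => Real.exp (t * (y - x)) :=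
    Filter.Eventually.of_forall fun _ => (Real.exp_pos _).le
  have hlevel : ∀ z ∈ Ioi (√q),
      μ {y | z < Real.exp (t * (y - x))} ≤ ENNReal.ofReal (q * z ^ (-2 : ℝ)) := by
    intro z hz
    have hz0 : 0 < z := hsq.trans hz
    have hset : {y | z < Real.exp (t * (y - x))} = Ioi (x + Real.log z / t) := by
      ext y
      rw [mem_ofPred_eq, ← Real.log_lt_iff_lt_exp hz0, mem_Ioi, ← lt_sub_iff_add_lt', div_lt_iff₀ ht,
        mul_comm]
    rw [hset, ← ofReal_measureReal]
    refine ENNReal.ofReal_le_ofReal ((htail _).trans_eq ?_)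
    rw [Real.rpow_def_of_pos hz0]
    congr 2
    field_simp
    ring
  have hlint : ∫⁻ y, ENNReal.ofReal (Real.exp (t * (y - x))) ∂μ ≤ ENNReal.ofReal (2 * √q) := by
    rw [lintegral_eq_lintegral_meas_lt μ h0 hm.aemeasurable, ← Ioc_union_Ioi_eq_Ioi hsq.le]
    refine (lintegral_union_le _ _ _).trans ?_
    rw [two_mul, ENNReal.ofReal_add hsq.le hsq.le]
    refine add_le_add ?_ ?_
    · calc _ ≤ ∫⁻ _ in Ioc 0 (√q), (1 : ENNReal) := lintegral_mono fun _ => prob_le_one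
        _ = _ := by simp
    · refine (setLIntegral_mono' measurableSet_Ioi hlevel).trans ?_
      rw [← ofReal_integral_eq_lintegral_ofReal]
      · rw [integral_const_mul, integral_Ioi_rpow_of_lt (by norm_num) hsq]
        refine ENNReal.ofReal_le_ofReal (le_of_eq ?_)
        norm_num [Real.rpow_neg_one]
        rw [← div_eq_mul_inv, Real.div_sqrt]
      · exact (integrableOn_Ioi_rpow_of_lt (by norm_num) hsq).const_mul _
      · refine (ae_restrict_mem measurableSet_Ioi).mono fun z hz => ?_
        have : 0 < z := hsq.trans hz
        positivity
  refine ⟨⟨hm.aestronglyMeasurable, ?_⟩, ?_⟩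
  · rw [hasFiniteIntegral_iff_ofReal h0]
    exact hlint.trans_lt ENNReal.ofReal_lt_top
  · rw [integral_eq_lintegral_of_nonneg_ae h0 hm.aestronglyMeasurable]
    exact ENNReal.toReal_le_of_le_ofReal (by positivity) hlint

namespace HasLogConcaveDensity

variable {μ : Measure ℝ} {f : ℝ → ℝ}

lemma exists_integral_exp_le_Ioi [IsProbabilityMeasure μ] (h : HasLogConcaveDensity μ f) {x : ℝ}
    (h1 : 0 < μ.real (Iic x)) (h2 : 0 < μ.real (Ioi x)) :
    ∃ t, Integrable (fun y => Real.exp (t * (y - x))) μ ∧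
      ∫ y, Real.exp (t * (y - x)) ∂μ ≤ 2 * √(μ.real (Ioi x)) := by
  have hs : 0 < f x / μ.real (Ioi x) := div_pos (h.density_pos h1 h2) h2
  refine ⟨_, integrable_exp_and_integral_le μ (half_pos hs) h2 fun y => ?_⟩
  rw [mul_div_cancel₀ _ two_ne_zero]
  exact h.real_Ioi_le_mul_exp h2 y

lemma map_neg_real_Iic (x : ℝ) : (μ.map Neg.neg).real (Iic (-x)) = μ.real (Ici x) := by
  rw [map_measureReal_apply measurable_neg measurableSet_Iic]
  simp

lemma map_neg_real_Ioi (x : ℝ) : (μ.map Neg.neg).real (Ioi (-x)) = μ.real (Iio x) := by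
  rw [map_measureReal_apply measurable_neg measurableSet_Ioi]
  simp

lemma real_Iio (h : HasLogConcaveDensity μ f) (x : ℝ) : μ.real (Iio x) = μ.real (Iic x) := by
  have := h.nullSingletonClass
  exact measureReal_congr Iio_ae_eq_Iic

lemma real_Ici (h : HasLogConcaveDensity μ f) (x : ℝ) : μ.real (Ici x) = μ.real (Ioi x) := by
  have := h.nullSingletonClass
  exact measureReal_congr Ioi_ae_eq_Ici.symm

lemma exists_integral_exp_le_Iic [IsProbabilityMeasure μ] (h : HasLogConcaveDensity μ f) {x : ℝ}
    (h1 : 0 < μ.real (Iic x)) (h2 : 0 < μ.real (Ioi x)) :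
    ∃ t, Integrable (fun y => Real.exp (t * (y - x))) μ ∧
      ∫ y, Real.exp (t * (y - x)) ∂μ ≤ 2 * √(μ.real (Iic x)) := by
  have : IsProbabilityMeasure (μ.map Neg.neg) :=
    Measure.isProbabilityMeasure_map measurable_neg.aemeasurable
  obtain ⟨t, ht, hle⟩ := h.map_neg.exists_integral_exp_le_Ioi (x := -x)
    (by rwa [map_neg_real_Iic, h.real_Ici]) (by rwa [map_neg_real_Ioi, h.real_Iio])
  have e : ∀ y, t * (-y - -x) = -t * (y - x) := fun y => by ring
  have hmeas : AEStronglyMeasurable (fun y => Real.exp (t * (y - -x))) (μ.map Neg.neg) :=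
    ht.aestronglyMeasurable
  rw [integrable_map_measure hmeas measurable_neg.aemeasurable] at ht
  rw [integral_map measurable_neg.aemeasurable hmeas, map_neg_real_Ioi, h.real_Iio] at hle
  simp only [Function.comp_def, e] at ht hle
  exact ⟨-t, ht, hle⟩

lemma ae_real_Ioi_pos [IsProbabilityMeasure μ] (h : HasLogConcaveDensity μ f) :
    ∀ᵐ x ∂μ, 0 < μ.real (Ioi x) := by
  rw [ae_iff]
  refine nonpos_iff_eq_zero.1 (le_of_forall_pos_le_add fun ε hε => ?_)
  rw [zero_add]
  obtain ⟨δ, hδ0, hδ⟩ := ENNReal.lt_iff_exists_nnreal_btwn.1 hε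
  obtain ⟨a, ha⟩ := h.exists_real_Ioi_eq (c := min δ 2⁻¹)
    ⟨lt_min (by exact_mod_cast hδ0) (by norm_num), (min_le_right _ _).trans_lt (by norm_num)⟩
  have ha0 : 0 < μ.real (Ioi a) := by
    rw [ha]; exact lt_min (by exact_mod_cast hδ0) (by norm_num)
  calc μ {x | ¬0 < μ.real (Ioi x)} ≤ μ (Ioi a) := by
        refine measure_mono fun x hx => ?_
        by_contra hxa
        exact hx (ha0.trans_le (measureReal_mono (Ioi_subset_Ioi (not_lt.1 hxa))))
    _ = ENNReal.ofReal (μ.real (Ioi a)) := (ofReal_measureReal (measure_ne_top _ _)).symm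
    _ ≤ ENNReal.ofReal δ := ENNReal.ofReal_le_ofReal (ha.trans_le (min_le_left _ _))
    _ ≤ ε := by rw [ENNReal.ofReal_coe_nnreal]; exact hδ.le

lemma ae_real_Iic_pos [IsProbabilityMeasure μ] (h : HasLogConcaveDensity μ f) :
    ∀ᵐ x ∂μ, 0 < μ.real (Iic x) := by
  have : IsProbabilityMeasure (μ.map Neg.neg) :=
    Measure.isProbabilityMeasure_map measurable_neg.aemeasurable
  filter_upwards [ae_of_ae_map measurable_neg.aemeasurable h.map_neg.ae_real_Ioi_pos] with x hx
  rwa [map_neg_real_Ioi, h.real_Iio] at hx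

end HasLogConcaveDensity

lemma cramer1_nonneg (μ : Measure ℝ) [IsProbabilityMeasure μ] (x : ℝ) : 0 ≤ cramer1 μ x := by
  unfold cramer1
  by_cases hb : BddAbove (range fun t : {t : ℝ // Integrable (fun y => Real.exp (t * y)) μ} =>
      x * t.1 - Real.log (∫ y, Real.exp (t.1 * y) ∂μ))
  · refine le_trans ?_ (le_ciSup hb ⟨0, by simp⟩)
    simp
  · rw [Real.iSup_of_not_bddAbove hb]

lemma bddAbove_cramer1 (μ : Measure ℝ) [IsProbabilityMeasure μ] {x : ℝ}
    (h1 : 0 < μ.real (Iic x)) (h2 : 0 < μ.real (Ioi x)) :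
    BddAbove (range fun t : {t : ℝ // Integrable (fun y => Real.exp (t * y)) μ} =>
      x * t.1 - Real.log (∫ y, Real.exp (t.1 * y) ∂μ)) := by
  refine ⟨-Real.log (min (μ.real (Iic x)) (μ.real (Ioi x))), ?_⟩
  rintro _ ⟨⟨t, ht⟩, rfl⟩
  have hm := mul_meas_ge_le_integral_of_nonneg
    (Filter.Eventually.of_forall fun y => (Real.exp_pos (t * y)).le) ht (Real.exp (t * x))
  have hp : min (μ.real (Iic x)) (μ.real (Ioi x)) ≤
      μ.real {y | Real.exp (t * x) ≤ Real.exp (t * y)} := by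
    rcases le_total 0 t with h0 | h0
    · refine (min_le_right _ _).trans (measureReal_mono fun y hy => ?_)
      exact Real.exp_le_exp.2 (mul_le_mul_of_nonneg_left (le_of_lt hy) h0)
    · refine (min_le_left _ _).trans (measureReal_mono fun y hy => ?_)
      exact Real.exp_le_exp.2 (mul_le_mul_of_nonpos_left hy h0)
  have hpos := lt_min h1 h2
  have hle : Real.exp (t * x) * min (μ.real (Iic x)) (μ.real (Ioi x)) ≤
      ∫ y, Real.exp (t * y) ∂μ := le_trans (by gcongr) hm
  have := Real.log_le_log (by positivity) hle
  rw [Real.log_mul (Real.exp_pos _).ne' hpos.ne', Real.log_exp] at this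
  simp only
  linarith

/-- Any exponential moment of `X - x` bounds `exp (-Λ* x)` from above. -/
lemma exp_neg_cramer1_le_of_integral_le (μ : Measure ℝ) [IsProbabilityMeasure μ] {x t B : ℝ}
    (h1 : 0 < μ.real (Iic x)) (h2 : 0 < μ.real (Ioi x))
    (ht : Integrable (fun y => Real.exp (t * (y - x))) μ)
    (hB : ∫ y, Real.exp (t * (y - x)) ∂μ ≤ B) : Real.exp (-cramer1 μ x) ≤ B := by
  have e : ∀ y, Real.exp (t * y) = Real.exp (t * x) * Real.exp (t * (y - x)) := fun y => by
    rw [← Real.exp_add]; ring_nf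
  have hi : Integrable (fun y => Real.exp (t * y)) μ := by
    rw [funext e]
    exact ht.const_mul _
  have hpos : 0 < ∫ y, Real.exp (t * (y - x)) ∂μ := integral_exp_pos ht
  have hle : x * t - Real.log (∫ y, Real.exp (t * y) ∂μ) ≤ cramer1 μ x :=
    le_ciSup (bddAbove_cramer1 μ h1 h2) ⟨t, hi⟩
  rw [funext e, integral_const_mul, Real.log_mul (Real.exp_pos _).ne' hpos.ne', Real.log_exp] at hle
  refine le_trans ?_ hB
  rw [← Real.le_log_iff_exp_le hpos]
  linarith

/-- For every log-concave real random variable `X` with continuous distribution (i.e. with a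
log-concave density `f`), `E exp(−Λ*_X(X)) ≤ 1 − 1/(4e)`. -/
theorem exp_neg_cramer_le (μ : Measure ℝ) [IsProbabilityMeasure μ] (f : ℝ → ℝ)
    (hf0 : ∀ x, 0 ≤ f x)
    (hμ : μ = MeasureTheory.volume.withDensity fun x => ENNReal.ofReal (f x))
    (hlc : ∀ x y : ℝ, ∀ l ∈ Set.Ioo (0 : ℝ) 1,
      f x ^ (1 - l) * f y ^ l ≤ f ((1 - l) * x + l * y)) :
    ∫ x, Real.exp (-(cramer1 μ x)) ∂μ ≤ 1 - 1 / (4 * Real.exp 1) := by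
  have h : HasLogConcaveDensity μ f := ⟨hf0, hμ, hlc⟩
  have hsum := HasLogConcaveDensity.real_Iic_add_real_Ioi (μ := μ)
  obtain ⟨b₁, hb₁⟩ := h.exists_real_Ioi_eq (c := 1 / 25) ⟨by norm_num, by norm_num⟩
  obtain ⟨b₂, hb₂⟩ := h.exists_real_Ioi_eq (c := 1 / 9) ⟨by norm_num, by norm_num⟩
  obtain ⟨a₁, ha₁⟩ := h.exists_real_Ioi_eq (c := 24 / 25) ⟨by norm_num, by norm_num⟩
  obtain ⟨a₂, ha₂⟩ := h.exists_real_Ioi_eq (c := 8 / 9) ⟨by norm_num, by norm_num⟩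
  have anti : ∀ {x y : ℝ}, x ≤ y → μ.real (Ioi y) ≤ μ.real (Ioi x) := fun hxy =>
    measureReal_mono (Ioi_subset_Ioi hxy)
  have hord : ∀ {x y : ℝ}, μ.real (Ioi y) < μ.real (Ioi x) → x < y := fun hxy => by
    by_contra! hcon
    exact absurd (anti hcon) (not_le.2 hxy)
  have hab₁ : a₁ < a₂ := hord (by rw [ha₁, ha₂]; norm_num)
  have hab : a₂ < b₂ := hord (by rw [ha₂, hb₂]; norm_num)
  have hab₂ : b₂ < b₁ := hord (by rw [hb₁, hb₂]; norm_num)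
  let φ : ℝ → ℝ := (fun _ => 1) - (Ioi b₂).indicator (fun _ => 1 / 3)
    - (Ioi b₁).indicator (fun _ => 4 / 15) - (Iic a₂).indicator (fun _ => 1 / 3)
    - (Iic a₁).indicator (fun _ => 4 / 15)
  have hind : ∀ (s : Set ℝ) (c : ℝ), MeasurableSet s →
      Integrable (s.indicator fun _ => c) μ := fun s c hs => (integrable_const c).indicator hs
  have i₁ := hind (Ioi b₂) (1 / 3) measurableSet_Ioi
  have i₂ := hind (Ioi b₁) (4 / 15) measurableSet_Ioi
  have i₃ := hind (Iic a₂) (1 / 3) measurableSet_Iic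
  have i₄ := hind (Iic a₁) (4 / 15) measurableSet_Iic
  have i₀ : Integrable (fun _ : ℝ => (1 : ℝ)) μ := integrable_const 1
  have hφi : Integrable φ μ := (((i₀.sub i₁).sub i₂).sub i₃).sub i₄
  have hle : ∀ᵐ x ∂μ, Real.exp (-(cramer1 μ x)) ≤ φ x := by
    filter_upwards [h.ae_real_Iic_pos, h.ae_real_Ioi_pos] with x hx₁ hx₂
    have hone : Real.exp (-(cramer1 μ x)) ≤ 1 :=
      Real.exp_le_one_iff.2 (neg_nonpos.2 (cramer1_nonneg μ x))
    have hup : ∀ c : ℝ, 0 ≤ c → μ.real (Ioi x) ≤ c ^ 2 → Real.exp (-(cramer1 μ x)) ≤ 2 * c := by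
      intro c hc hxc
      obtain ⟨t, ht, hB⟩ := h.exists_integral_exp_le_Ioi hx₁ hx₂
      refine (exp_neg_cramer1_le_of_integral_le μ hx₁ hx₂ ht hB).trans ?_
      have := Real.sqrt_le_left hc |>.2 hxc
      linarith
    have hlow : ∀ c : ℝ, 0 ≤ c → μ.real (Iic x) ≤ c ^ 2 → Real.exp (-(cramer1 μ x)) ≤ 2 * c := by
      intro c hc hxc
      obtain ⟨t, ht, hB⟩ := h.exists_integral_exp_le_Iic hx₁ hx₂
      refine (exp_neg_cramer1_le_of_integral_le μ hx₁ hx₂ ht hB).trans ?_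
      have := Real.sqrt_le_left hc |>.2 hxc
      linarith
    have hs := hsum x
    simp only [φ, Pi.sub_apply, indicator_apply, mem_Ioi, mem_Iic]
    rcases lt_or_ge b₁ x with h₁ | h₁
    · have := hup (1 / 5) (by norm_num) (by linarith [anti h₁.le])
      rw [if_pos (by linarith), if_pos h₁, if_neg (by linarith), if_neg (by linarith)]
      linarith
    rcases lt_or_ge b₂ x with h₂ | h₂
    · have := hup (1 / 3) (by norm_num) (by linarith [anti h₂.le])
      rw [if_pos h₂, if_neg (by linarith), if_neg (by linarith), if_neg (by linarith)]
      linarith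
    rcases le_or_gt x a₁ with h₃ | h₃
    · have := hlow (1 / 5) (by norm_num) (by linarith [anti h₃])
      rw [if_neg (by linarith), if_neg (by linarith), if_pos (by linarith), if_pos h₃]
      linarith
    rcases le_or_gt x a₂ with h₄ | h₄
    · have := hlow (1 / 3) (by norm_num) (by linarith [anti h₄])
      rw [if_neg (by linarith), if_neg (by linarith), if_pos h₄, if_neg (by linarith)]
      linarith
    rw [if_neg (by linarith), if_neg (by linarith), if_neg (by linarith), if_neg (by linarith)]
    linarith
  have hφ : ∫ x, φ x ∂μ = 1 - 1 / 9 * (1 / 3) - 1 / 25 * (4 / 15) - 1 / 9 * (1 / 3)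
      - 1 / 25 * (4 / 15) := by
    have e₃ : μ.real (Iic a₂) = 1 / 9 := by linarith [hsum a₂]
    have e₄ : μ.real (Iic a₁) = 1 / 25 := by linarith [hsum a₁]
    rw [show φ = _ from rfl, integral_sub' (((i₀.sub i₁).sub i₂).sub i₃) i₄, integral_sub' ((i₀.sub i₁).sub i₂) i₃,
      integral_sub' (i₀.sub i₁) i₂, integral_sub' i₀ i₁, integral_indicator_const _ measurableSet_Ioi,
      integral_indicator_const _ measurableSet_Ioi, integral_indicator_const _ measurableSet_Iic,
      integral_indicator_const _ measurableSet_Iic, hb₁, hb₂, e₃, e₄]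
    simp
  calc ∫ x, Real.exp (-(cramer1 μ x)) ∂μ ≤ ∫ x, φ x ∂μ :=
        integral_mono_of_nonneg (Filter.Eventually.of_forall fun _ => (Real.exp_pos _).le) hφi hle
    _ ≤ 1 - 1 / (4 * Real.exp 1) := by
        have he := Real.exp_one_gt_d9
        have : 1 / (4 * Real.exp 1) ≤ 1 / (4 * 2.7) := by gcongr; linarith
        rw [hφ]
        norm_num at this ⊢
        linarith
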